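/- Let k ≥ 1 be an integer and let G be a graph with minimum degree δ(G) ≥ k − 1. If it is not the case that d×k(G) = 2 and d×k,t(G) = 1, then d×k^r(G) = d×k(G). -/

import Mathlib

/-- `S` is a `k`-tuple restrained dominating set of `G`: every vertex has at least `k`
vertices of `S` in its closed neighborhood, and every vertex outside `S` has at least
`k` neighbors outside `S`. -/
def SimpleGraph.IsKRDS {V : Type*} (G : SimpleGraph V) (k : ℕ) (S : Set V) : Prop :=
  (∀ x : V, k ≤ ((insert x (G.neighborSet x)) ∩ S).ncard) ∧
  ∀ x : V, x ∉ S → k ≤ (G.neighborSet x \ S).ncard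

/-- The `k`-tuple restrained domination number of `G`. -/
noncomputable def SimpleGraph.kRDNum {V : Type*} [Fintype V] (G : SimpleGraph V) (k : ℕ) : ℕ :=
  sInf {m | ∃ S : Set V, G.IsKRDS k S ∧ S.ncard = m}

/-- The `k`-tuple restrained domatic number of `G`: the maximum number of classes of a
partition of the vertex set all of whose classes are `k`-tuple restrained dominating
sets (0 if no such partition exists). -/
noncomputable def SimpleGraph.kRDomatic {V : Type*} [Fintype V] (G : SimpleGraph V) (k : ℕ) : ℕ :=
  sSup {d | ∃ f : V → Fin d, ∀ i : Fin d, G.IsKRDS k (f ⁻¹' {i})}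

/-- `S` is a `k`-tuple dominating set of `G`: every vertex has at least `k` vertices
of `S` in its closed neighborhood. -/
def SimpleGraph.IsKDS {V : Type*} (G : SimpleGraph V) (k : ℕ) (S : Set V) : Prop :=
  ∀ x : V, k ≤ ((insert x (G.neighborSet x)) ∩ S).ncard

/-- `S` is a `k`-tuple total dominating set of `G`: every vertex has at least `k`
neighbors in `S`. -/
def SimpleGraph.IsKTDS {V : Type*} (G : SimpleGraph V) (k : ℕ) (S : Set V) : Prop :=
  ∀ x : V, k ≤ (G.neighborSet x ∩ S).ncard

/-- The `k`-tuple domatic number of `G` (0 if no partition into kDSs exists). -/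
noncomputable def SimpleGraph.kDomatic {V : Type*} [Fintype V] (G : SimpleGraph V) (k : ℕ) : ℕ :=
  sSup {d | ∃ f : V → Fin d, ∀ i : Fin d, G.IsKDS k (f ⁻¹' {i})}

/-- The `k`-tuple total domatic number of `G` (0 if no partition into kTDSs exists). -/
noncomputable def SimpleGraph.kTDomatic {V : Type*} [Fintype V] (G : SimpleGraph V) (k : ℕ) : ℕ :=
  sSup {d | ∃ f : V → Fin d, ∀ i : Fin d, G.IsKTDS k (f ⁻¹' {i})}

namespace SimpleGraph

variable {V : Type*} {G : SimpleGraph V} {k : ℕ}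

theorem IsKTDS.isKDS [Finite V] {S : Set V} (hS : G.IsKTDS k S) : G.IsKDS k S := fun x =>
  (hS x).trans (Set.ncard_le_ncard (Set.inter_subset_inter_left _ (Set.subset_insert _ _))
    (Set.toFinite _))

theorem IsKDS.nonempty [Nonempty V] {S : Set V} (hk : 1 ≤ k) (hS : G.IsKDS k S) :
    S.Nonempty := by
  obtain ⟨x⟩ := ‹Nonempty V›
  have hne : ((insert x (G.neighborSet x)) ∩ S).ncard ≠ 0 := by
    have := hS x
    omega
  exact (Set.nonempty_of_ncard_ne_zero hne).mono Set.inter_subset_right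

theorem IsKDS.le_ncard_neighborSet_inter {S : Set V} (hS : G.IsKDS k S) {x : V} (hx : x ∉ S) :
    k ≤ (G.neighborSet x ∩ S).ncard := by
  simpa [Set.insert_inter_of_notMem hx] using hS x

/-- The number of classes of a partition into `k`-tuple dominating sets is bounded. -/
theorem bddAbove_isKDS_partition [Fintype V] [Nonempty V] (G : SimpleGraph V) (hk : 1 ≤ k) :
    BddAbove {d | ∃ f : V → Fin d, ∀ i : Fin d, G.IsKDS k (f ⁻¹' {i})} := by
  refine ⟨Fintype.card V, ?_⟩
  rintro d ⟨f, hf⟩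
  have hsurj : Function.Surjective f := fun i => (hf i).nonempty hk
  simpa using Fintype.card_le_of_surjective f hsurj

/-- A partition into at least three `k`-tuple dominating sets is a partition into `k`-tuple
restrained dominating sets. -/
theorem isKRDS_of_isKDS_partition [Finite V] {d : ℕ} (hd : 3 ≤ d) {f : V → Fin d}
    (hf : ∀ i, G.IsKDS k (f ⁻¹' {i})) (i : Fin d) : G.IsKRDS k (f ⁻¹' {i}) := by
  refine ⟨hf i, fun x hx => ?_⟩
  obtain ⟨l, hl⟩ : ∃ l : Fin d, l ∉ ({f x, i} : Finset (Fin d)) := by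
    by_contra! hall
    have h₁ : (Finset.univ : Finset (Fin d)).card ≤ ({f x, i} : Finset (Fin d)).card :=
      Finset.card_le_card fun l _ => hall l
    have h₂ := Finset.card_le_two (a := f x) (b := i)
    simp only [Finset.card_univ, Fintype.card_fin] at h₁
    omega
  simp only [Finset.mem_insert, Finset.mem_singleton, not_or] at hl
  refine ((hf l).le_ncard_neighborSet_inter (x := x) fun hxl => hl.1 hxl.symm).trans
    (Set.ncard_le_ncard ?_ (Set.toFinite _))
  rintro y ⟨hy, rfl⟩
  exact ⟨hy, hl.2⟩

/-- A partition into `k`-tuple total dominating sets is a partition into `k`-tuple restrained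
dominating sets. -/
theorem isKRDS_of_isKTDS_partition [Finite V] {ι : Type*} {f : V → ι}
    (hf : ∀ i, G.IsKTDS k (f ⁻¹' {i})) (i : ι) : G.IsKRDS k (f ⁻¹' {i}) := by
  refine ⟨(hf i).isKDS, fun x hx => (hf (f x) x).trans (Set.ncard_le_ncard ?_ (Set.toFinite _))⟩
  rintro y ⟨hy, hyx⟩
  exact ⟨hy, fun hyi => hx (hyx.symm.trans hyi)⟩

/-- Two disjoint `k`-tuple dominating sets force degree at least `k`. -/
theorem le_ncard_neighborSet_of_disjoint [Finite V] {S T : Set V}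
    (hS : G.IsKDS k S) (hT : G.IsKDS k T) (hST : Disjoint S T) (x : V) :
    k ≤ (G.neighborSet x).ncard := by
  by_cases hx : x ∈ S
  · exact (hT.le_ncard_neighborSet_inter (hST.notMem_of_mem_left hx)).trans
      (Set.ncard_le_ncard Set.inter_subset_left (Set.toFinite _))
  · exact (hS.le_ncard_neighborSet_inter hx).trans
      (Set.ncard_le_ncard Set.inter_subset_left (Set.toFinite _))

end SimpleGraph

/-- If it is not the case that d×k(G) = 2 and d×k,t(G) = 1, then
d×k^r(G) = d×k(G). -/
theorem kRDomatic_eq_kDomatic {V : Type*} [Fintype V] (G : SimpleGraph V) (k : ℕ)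
    (hk : 1 ≤ k) (hdeg : ∀ v : V, k - 1 ≤ (G.neighborSet v).ncard)
    (h : ¬ (G.kDomatic k = 2 ∧ G.kTDomatic k = 1)) :
    G.kRDomatic k = G.kDomatic k := by
  rcases isEmpty_or_nonempty V with hV | hV
  · simp [SimpleGraph.kRDomatic, SimpleGraph.kDomatic, SimpleGraph.IsKRDS, SimpleGraph.IsKDS]
  have hbdd := G.bddAbove_isKDS_partition hk
  have hsub : {d | ∃ f : V → Fin d, ∀ i : Fin d, G.IsKRDS k (f ⁻¹' {i})} ⊆
      {d | ∃ f : V → Fin d, ∀ i : Fin d, G.IsKDS k (f ⁻¹' {i})} :=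
    fun d ⟨f, hf⟩ => ⟨f, fun i => (hf i).1⟩
  have hbddT : BddAbove {d | ∃ f : V → Fin d, ∀ i : Fin d, G.IsKTDS k (f ⁻¹' {i})} :=
    by
    refine hbdd.mono ?_
    rintro d ⟨f, hf⟩
    exact ⟨f, fun i => (hf i).isKDS⟩
  have hone : 1 ∈ {d | ∃ f : V → Fin d, ∀ i : Fin d, G.IsKRDS k (f ⁻¹' {i})} := by
    refine ⟨fun _ => 0, fun i => ⟨fun x => ?_, fun x hx => (hx (Subsingleton.elim _ _)).elim⟩⟩
    have huniv : (fun _ : V => (0 : Fin 1)) ⁻¹' {i} = Set.univ :=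
      Set.eq_univ_of_forall fun _ => Subsingleton.elim _ _
    rw [huniv, Set.inter_univ, Set.ncard_insert_of_notMem (by simp) (Set.toFinite _)]
    have := hdeg x
    omega
  have hle : G.kRDomatic k ≤ G.kDomatic k := csSup_le_csSup hbdd ⟨1, hone⟩ hsub
  have hge : 1 ≤ G.kRDomatic k := le_csSup (hbdd.mono hsub) hone
  obtain ⟨f, hf⟩ : ∃ f : V → Fin (G.kDomatic k), ∀ i, G.IsKDS k (f ⁻¹' {i}) :=
    Nat.sSup_mem ⟨1, hsub hone⟩ hbdd
  refine hle.antisymm ?_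
  by_cases hthree : 3 ≤ G.kDomatic k
  · exact le_csSup (hbdd.mono hsub) ⟨f, SimpleGraph.isKRDS_of_isKDS_partition hthree hf⟩
  by_cases htwo : G.kDomatic k = 2
  · have hdeg' : ∀ x, k ≤ (G.neighborSet x).ncard :=
      SimpleGraph.le_ncard_neighborSet_of_disjoint (hf ⟨0, by omega⟩) (hf ⟨1, by omega⟩)
        (Disjoint.preimage f (by simp))
    have honeT : 1 ∈ {d | ∃ f : V → Fin d, ∀ i : Fin d, G.IsKTDS k (f ⁻¹' {i})} := by
      refine ⟨fun _ => 0, fun i x => ?_⟩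
      have huniv : (fun _ : V => (0 : Fin 1)) ⁻¹' {i} = Set.univ :=
        Set.eq_univ_of_forall fun _ => Subsingleton.elim _ _
      simpa only [huniv, Set.inter_univ] using hdeg' x
    have hgeT : 1 ≤ G.kTDomatic k := le_csSup hbddT honeT
    obtain ⟨g, hg⟩ : ∃ g : V → Fin (G.kTDomatic k), ∀ i, G.IsKTDS k (g ⁻¹' {i}) :=
      Nat.sSup_mem ⟨1, honeT⟩ hbddT
    have hTR : G.kTDomatic k ≤ G.kRDomatic k :=
      le_csSup (hbdd.mono hsub) ⟨g, SimpleGraph.isKRDS_of_isKTDS_partition hg⟩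
    omega
  · omega
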